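/- For every point x in X = supp(μ), the lower local dimension satisfies −log(1−p)/log A ≤ d̲(μ,x) ≤ −log p/log A. -/

import Mathlib

open MeasureTheory Filter Set Metric Topology

/-- `moranCyl c w n (x, ℓ)` refines the interval `[x, x + ℓ]` along the binary word `w`,
using the contraction ratio `c k` at step `k` (the first letter of `w` is processed with
index `n`).  The result `(x', ℓ')` describes the interval `[x', x' + ℓ']`. -/
noncomputable def moranCyl (c : ℕ → ℝ) : List Bool → ℕ → ℝ × ℝ → ℝ × ℝ
  | [], _, st => st
  | bb :: w, n, st =>
      moranCyl c w (n + 1)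
        (if bb then (st.1 + st.2 - st.2 / c n, st.2 / c n) else (st.1, st.2 / c n))

/-- The basic interval `I_w` of the Moran construction with ratios `c`. -/
noncomputable def moranI (c : ℕ → ℝ) (w : List Bool) : Set ℝ :=
  Icc (moranCyl c w 1 (0, 1)).1 ((moranCyl c w 1 (0, 1)).1 + (moranCyl c w 1 (0, 1)).2)

/-- The length `|I_w|` of the basic interval `I_w`. -/
noncomputable def moranLen (c : ℕ → ℝ) (w : List Bool) : ℝ :=
  (moranCyl c w 1 (0, 1)).2

/-- The Moran set `⋂ n ⋃ {I_w : |w| = n}`. -/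
noncomputable def moranSet (c : ℕ → ℝ) : Set ℝ :=
  ⋂ n : ℕ, ⋃ w ∈ {w : List Bool | w.length = n}, moranI c w

/-- The mass assigned to the cylinder `I_w` by the Moran measure with weight `r k` for the
letter at step `k`: `cylMass r w 1 1 = μ(I_w)`. -/
noncomputable def cylMass (r : ℕ → ℝ) : List Bool → ℕ → ℝ → ℝ
  | [], _, m => m
  | bb :: w, n, m => cylMass r w (n + 1) (if bb then (1 - r n) * m else r n * m)

/-- Lower local dimension `liminf_{r → 0⁺} log μ(B(x,r)) / log r`. -/
noncomputable def lowerLocalDim (μ : Measure ℝ) (x : ℝ) : ℝ :=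
  liminf (fun rr : ℝ => Real.log (μ (closedBall x rr)).toReal / Real.log rr) (𝓝[>] 0)

/-- Upper local dimension `limsup_{r → 0⁺} log μ(B(x,r)) / log r`. -/
noncomputable def upperLocalDim (μ : Measure ℝ) (x : ℝ) : ℝ :=
  limsup (fun rr : ℝ => Real.log (μ (closedBall x rr)).toReal / Real.log rr) (𝓝[>] 0)

/-- `betaFn ρ C s = -log (ρ^s + (1-ρ)^s) / log C`; so `β₁ = betaFn p A`, `β₂ = betaFn q B`. -/
noncomputable def betaFn (ρ C : ℝ) (s : ℝ) : ℝ :=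
  -Real.log (ρ ^ s + (1 - ρ) ^ s) / Real.log C

/-- The Legendre transform `f^*(α) = inf_s (s α - f(s))`. -/
noncomputable def legendre (f : ℝ → ℝ) (α : ℝ) : ℝ :=
  ⨅ s : ℝ, (s * α - f s)

/-- The modification `β̃₁` of `β₁`, linear on `(0,1)`. -/
noncomputable def betaTilde1 (ρ C : ℝ) (s : ℝ) : ℝ :=
  if s ≤ 0 ∨ 1 ≤ s then betaFn ρ C s
  else (1 - s) * betaFn ρ C 0 + s * betaFn ρ C 1

/-- `packSup μ X r s` is the supremum of `∑ᵢ μ(B(xᵢ,r))^s` over all finite families of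
pairwise disjoint closed balls of radius `r` with centers in `X`. -/
noncomputable def packSup (μ : Measure ℝ) (X : Set ℝ) (rr s : ℝ) : ℝ :=
  sSup {y : ℝ | ∃ t : Finset ℝ, (↑t : Set ℝ) ⊆ X ∧
    (↑t : Set ℝ).Pairwise (fun u v => Disjoint (closedBall u rr) (closedBall v rr)) ∧
    y = ∑ u ∈ t, (μ (closedBall u rr)).toReal ^ s}

section Cylinders

variable {c r : ℕ → ℝ}

lemma moranCyl_append_singleton (b : Bool) (w : List Bool) (n : ℕ) (st : ℝ × ℝ) :
    moranCyl c (w ++ [b]) n st =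
      moranCyl c [b] (n + w.length) (moranCyl c w n st) := by
  induction w generalizing n st with
  | nil => rfl
  | cons a w ih =>
    rw [List.cons_append, moranCyl, ih, List.length_cons,
      show n + 1 + w.length = n + (w.length + 1) by omega]
    rfl

lemma cylMass_append_singleton (b : Bool) (w : List Bool) (n : ℕ) (m : ℝ) :
    cylMass r (w ++ [b]) n m =
      (if b then 1 - r (n + w.length) else r (n + w.length)) * cylMass r w n m := by
  induction w generalizing n m with
  | nil => cases b <;> rfl
  | cons a w ih =>
    rw [List.cons_append, cylMass, ih, cylMass, List.length_cons,
      show n + 1 + w.length = n + (w.length + 1) by omega]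

lemma moranLen_append_singleton (b : Bool) (w : List Bool) :
    moranLen c (w ++ [b]) = moranLen c w / c (1 + w.length) := by
  simp only [moranLen, moranCyl_append_singleton]
  cases b <;> simp [moranCyl]

lemma moranI_append_false (w : List Bool) :
    moranI c (w ++ [false]) = Icc (moranCyl c w 1 (0, 1)).1
      ((moranCyl c w 1 (0, 1)).1 + moranLen c w / c (1 + w.length)) := by
  simp only [moranI, moranLen, moranCyl_append_singleton]
  simp [moranCyl]

lemma moranI_append_true (w : List Bool) :
    moranI c (w ++ [true]) = Icc
      ((moranCyl c w 1 (0, 1)).1 + moranLen c w - moranLen c w / c (1 + w.length))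
      ((moranCyl c w 1 (0, 1)).1 + moranLen c w) := by
  simp only [moranI, moranLen, moranCyl_append_singleton]
  simp [moranCyl]

lemma moranI_eq (w : List Bool) :
    moranI c w = Icc (moranCyl c w 1 (0, 1)).1
      ((moranCyl c w 1 (0, 1)).1 + moranLen c w) := rfl

lemma moranLen_pos (hc : ∀ n, 1 ≤ n → 0 < c n) (w : List Bool) : 0 < moranLen c w := by
  induction w using List.reverseRecOn with
  | nil => simp [moranLen, moranCyl]
  | append_singleton w b ih =>
    rw [moranLen_append_singleton]
    exact div_pos ih (hc _ (by omega))

lemma moranLen_eq_of_length_eq {v w : List Bool} (h : v.length = w.length) :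
    moranLen c v = moranLen c w := by
  induction v using List.reverseRecOn generalizing w with
  | nil => rw [List.length_nil, eq_comm, List.length_eq_zero_iff] at h; rw [h]
  | append_singleton v b ih =>
    induction w using List.reverseRecOn with
    | nil => simp at h
    | append_singleton w b' _ =>
      have h' : v.length = w.length := by simpa using h
      rw [moranLen_append_singleton, moranLen_append_singleton, ih h', h']

lemma moranLen_le_pow (hc : ∀ n, 1 ≤ n → 2 < c n) (w : List Bool) :
    moranLen c w ≤ (1 / 2 : ℝ) ^ w.length := by
  induction w using List.reverseRecOn with
  | nil => simp [moranLen, moranCyl]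
  | append_singleton w b ih =>
    have h0 := moranLen_pos (c := c) (fun n hn => by linarith [hc n hn]) w
    have h2 := hc (1 + w.length) (by omega)
    rw [moranLen_append_singleton, List.length_append, List.length_singleton, pow_succ,
      div_eq_mul_one_div]
    gcongr

lemma log_moranLen_le (hc : ∀ n, 1 ≤ n → 2 < c n) (w : List Bool) :
    Real.log (moranLen c w) ≤ -(w.length * Real.log 2) := by
  have h := Real.log_le_log (moranLen_pos (c := c) (fun n hn => by linarith [hc n hn]) w)
    (moranLen_le_pow hc w)
  rw [Real.log_pow, one_div, Real.log_inv] at h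
  linarith

lemma cylMass_pos (hr : ∀ n, 1 ≤ n → 0 < r n ∧ r n < 1) (w : List Bool) :
    0 < cylMass r w 1 1 := by
  induction w using List.reverseRecOn with
  | nil => simp [cylMass]
  | append_singleton w b ih =>
    rw [cylMass_append_singleton]
    obtain ⟨h1, h2⟩ := hr (1 + w.length) (by omega)
    refine mul_pos ?_ ih
    split_ifs <;> linarith

lemma log_cylMass_append_singleton (hr : ∀ n, 1 ≤ n → 0 < r n ∧ r n ≤ 1 / 2)
    (b : Bool) (w : List Bool) :
    Real.log (r (1 + w.length)) + Real.log (cylMass r w 1 1) ≤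
        Real.log (cylMass r (w ++ [b]) 1 1) ∧
      Real.log (cylMass r (w ++ [b]) 1 1) ≤
        Real.log (1 - r (1 + w.length)) + Real.log (cylMass r w 1 1) := by
  obtain ⟨h1, h2⟩ := hr (1 + w.length) (by omega)
  have h0 := cylMass_pos (fun n hn => ⟨(hr n hn).1, by linarith [(hr n hn).2]⟩) w
  have h3 : Real.log (r (1 + w.length)) ≤ Real.log (1 - r (1 + w.length)) :=
    Real.log_le_log h1 (by linarith)
  rw [cylMass_append_singleton, Real.log_mul (by split_ifs <;> linarith) h0.ne']
  cases b <;> simp [h3]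

lemma log_moranLen_append_singleton (hc : ∀ n, 1 ≤ n → 0 < c n) (b : Bool) (w : List Bool) :
    Real.log (moranLen c (w ++ [b])) =
      Real.log (moranLen c w) - Real.log (c (1 + w.length)) := by
  rw [moranLen_append_singleton,
    Real.log_div (moranLen_pos hc w).ne' (hc _ (by omega)).ne']

/-- If every weight is at most `c n ^ (-s)`, then every cylinder satisfies
`μ(I_w) ≤ |I_w| ^ s` (in logarithmic form). -/
lemma log_cylMass_le {s : ℝ} (hc : ∀ n, 1 ≤ n → 0 < c n)
    (hr : ∀ n, 1 ≤ n → 0 < r n ∧ r n ≤ 1 / 2)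
    (hs : ∀ n, 1 ≤ n → Real.log (1 - r n) ≤ -(s * Real.log (c n))) (w : List Bool) :
    Real.log (cylMass r w 1 1) ≤ s * Real.log (moranLen c w) := by
  induction w using List.reverseRecOn with
  | nil => simp [moranLen, moranCyl, cylMass]
  | append_singleton w b ih =>
    rw [log_moranLen_append_singleton hc]
    have := (log_cylMass_append_singleton hr b w).2
    have := hs (1 + w.length) (by omega)
    linarith

lemma le_log_cylMass {t K : ℝ} {m n : ℕ} (hc : ∀ n, 1 ≤ n → 0 < c n)
    (hr : ∀ n, 1 ≤ n → 0 < r n ∧ r n ≤ 1 / 2)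
    (hsmall : ∀ k, 1 ≤ k → k ≤ m → -K ≤ Real.log (r k) + t * Real.log (c k))
    (hlarge : ∀ k, m < k → k ≤ n → 0 ≤ Real.log (r k) + t * Real.log (c k))
    (w : List Bool) (hw : w.length ≤ n) :
    t * Real.log (moranLen c w) - K * (min w.length m : ℕ) ≤
      Real.log (cylMass r w 1 1) := by
  induction w using List.reverseRecOn with
  | nil => simp [moranLen, moranCyl, cylMass]
  | append_singleton w b ih =>
    rw [List.length_append, List.length_singleton] at hw ⊢
    specialize ih (by omega)
    rw [log_moranLen_append_singleton hc]
    have h1 := (log_cylMass_append_singleton hr b w).1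
    rcases le_or_gt (w.length + 1) m with h | h
    · have h2 := hsmall (1 + w.length) (by omega) (by omega)
      rw [min_eq_left (by omega)] at ih ⊢
      push_cast
      linarith
    · have h2 := hlarge (1 + w.length) (by omega) (by omega)
      rw [min_eq_right (by omega)] at ih ⊢
      linarith

lemma moranI_append_subset (hc : ∀ n, 1 ≤ n → 2 < c n) (b : Bool) (w : List Bool) :
    moranI c (w ++ [b]) ⊆ moranI c w := by
  have h2 := hc (1 + w.length) (by omega)
  have h0 := moranLen_pos (c := c) (fun n hn => by linarith [hc n hn]) w
  have h3 : moranLen c w / c (1 + w.length) ≤ moranLen c w :=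
    div_le_self h0.le (by linarith)
  cases b
  · rw [moranI_append_false, moranI_eq]
    exact Icc_subset_Icc le_rfl (by linarith)
  · rw [moranI_append_true, moranI_eq]
    exact Icc_subset_Icc (by linarith) le_rfl

lemma lt_dist_of_mem_moranI_append {B : ℝ} (hB : 2 < B) (hc : ∀ n, 1 ≤ n → B ≤ c n)
    (b : Bool) (w : List Bool) {x y : ℝ}
    (hx : x ∈ moranI c (w ++ [b])) (hy : y ∈ moranI c (w ++ [!b])) :
    (1 - 2 / B) * moranLen c w ≤ dist y x := by
  have h2 := hc (1 + w.length) (by omega)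
  have h0 := moranLen_pos (c := c) (fun n hn => by linarith [hc n hn]) w
  have h3 : moranLen c w / c (1 + w.length) ≤ moranLen c w / B := by gcongr
  have h4 : (1 - 2 / B) * moranLen c w = moranLen c w - 2 * (moranLen c w / B) := by ring
  rw [h4, Real.dist_eq]
  cases b
  · rw [Bool.not_false, moranI_append_true] at hy
    rw [moranI_append_false] at hx
    exact le_trans (by linarith [hx.2, hy.1]) (le_abs_self _)
  · rw [Bool.not_true, moranI_append_false] at hy
    rw [moranI_append_true] at hx
    exact le_trans (by linarith [hx.1, hy.2]) (neg_le_abs _)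

/-- The gap between the two children of a cylinder carries no mass. -/
lemma measure_moranI_diff {μ : Measure ℝ} [IsProbabilityMeasure μ]
    {B : ℝ} (hB : 2 < B) (hc : ∀ n, 1 ≤ n → B ≤ c n)
    (hr : ∀ n, 1 ≤ n → 0 < r n ∧ r n < 1)
    (hμ : ∀ w : List Bool, μ (moranI c w) = ENNReal.ofReal (cylMass r w 1 1))
    (b : Bool) (w : List Bool) :
    μ (moranI c w \ (moranI c (w ++ [b]) ∪ moranI c (w ++ [!b]))) = 0 := by
  have hmeas : ∀ v, MeasurableSet (moranI c v) := fun v => measurableSet_Icc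
  have hc2 : ∀ n, 1 ≤ n → 2 < c n := fun n hn => by linarith [hc n hn]
  have hdisj : Disjoint (moranI c (w ++ [b])) (moranI c (w ++ [!b])) := by
    rw [Set.disjoint_left]
    intro y hy hy'
    have h := lt_dist_of_mem_moranI_append hB hc b w hy hy'
    rw [dist_self] at h
    have h0 := moranLen_pos (c := c) (fun n hn => by linarith [hc n hn]) w
    have h1 : 2 / B < 1 := (div_lt_one (by linarith)).2 hB
    nlinarith
  have hsum : μ (moranI c (w ++ [b]) ∪ moranI c (w ++ [!b])) = μ (moranI c w) := by
    rw [measure_union hdisj (hmeas _), hμ, hμ, hμ,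
      ← ENNReal.ofReal_add (cylMass_pos hr _).le (cylMass_pos hr _).le,
      cylMass_append_singleton, cylMass_append_singleton]
    congr 1
    cases b <;> simp <;> ring
  rw [measure_sdiff (union_subset (moranI_append_subset hc2 _ _) (moranI_append_subset hc2 _ _))
    ((hmeas _).union (hmeas _)).nullMeasurableSet (measure_ne_top _ _), hsum, tsub_self]

/-- A ball centred in `I_w` with radius small compared to `|I_w|` has no more mass than `I_w`. -/
lemma measure_closedBall_le {μ : Measure ℝ} [IsProbabilityMeasure μ]
    {B : ℝ} (hB : 2 < B) (hc : ∀ n, 1 ≤ n → B ≤ c n)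
    (hr : ∀ n, 1 ≤ n → 0 < r n ∧ r n < 1)
    (hμ : ∀ w : List Bool, μ (moranI c w) = ENNReal.ofReal (cylMass r w 1 1))
    {x ρ : ℝ} (w : List Bool) (hx : x ∈ moranI c w) (hρ : ρ < (1 - 2 / B) * moranLen c w) :
    μ (closedBall x ρ) ≤ μ (moranI c w) := by
  have hc2 : ∀ n, 1 ≤ n → 2 < c n := fun n hn => by linarith [hc n hn]
  have hδ : 0 < 1 - 2 / B := by
    have h1 : 2 / B < 1 := (div_lt_one (by linarith)).2 hB
    linarith
  suffices h : μ (closedBall x ρ \ moranI c w) = 0 from measure_mono_ae (ae_le_set.2 h)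
  induction w using List.reverseRecOn with
  | nil =>
    refine measure_mono_null (sdiff_subset_sdiff_left (subset_univ _)) ?_
    rw [← compl_eq_univ_sdiff, prob_compl_eq_zero_iff (show MeasurableSet (moranI c []) from
      measurableSet_Icc), hμ]
    simp [cylMass]
  | append_singleton w b ih =>
    have h0 := moranLen_pos (c := c) (fun n hn => by linarith [hc n hn]) w
    have hlen : moranLen c (w ++ [b]) ≤ moranLen c w := by
      rw [moranLen_append_singleton]
      exact div_le_self h0.le (by linarith [hc2 (1 + w.length) (by omega)])
    have hρ' : ρ < (1 - 2 / B) * moranLen c w := hρ.trans_le (by gcongr)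
    refine measure_mono_null (t := (closedBall x ρ \ moranI c w) ∪
      (moranI c w \ (moranI c (w ++ [b]) ∪ moranI c (w ++ [!b])))) ?_
      (measure_union_null (ih (moranI_append_subset hc2 b w hx) hρ')
        (measure_moranI_diff hB hc hr hμ b w))
    rintro y ⟨hy, hyb⟩
    by_cases hyw : y ∈ moranI c w
    · refine Or.inr ⟨hyw, ?_⟩
      rintro (h | h)
      · exact hyb h
      · have := lt_dist_of_mem_moranI_append hB hc b w hx h
        rw [mem_closedBall] at hy
        linarith
    · exact Or.inl ⟨hy, hyw⟩

lemma moranI_subset_closedBall {x : ℝ} {w : List Bool} (hx : x ∈ moranI c w) :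
    moranI c w ⊆ closedBall x (moranLen c w) := by
  intro y hy
  rw [moranI_eq] at hx hy
  rw [mem_closedBall, Real.dist_eq, abs_le]
  constructor <;> linarith [hx.1, hx.2, hy.1, hy.2]

lemma exists_word_of_mem_moranSet {x : ℝ} (hx : x ∈ moranSet c) (n : ℕ) :
    ∃ w : List Bool, w.length = n ∧ x ∈ moranI c w := by
  have h := mem_iInter.1 hx n
  simpa using h

lemma measure_closedBall_toReal_pos {μ : Measure ℝ} [IsProbabilityMeasure μ]
    (hc : ∀ n, 1 ≤ n → 2 < c n) (hr : ∀ n, 1 ≤ n → 0 < r n ∧ r n < 1)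
    (hμ : ∀ w : List Bool, μ (moranI c w) = ENNReal.ofReal (cylMass r w 1 1))
    {x ρ : ℝ} (hx : x ∈ moranSet c) (hρ : 0 < ρ) : 0 < (μ (closedBall x ρ)).toReal := by
  obtain ⟨n, hn⟩ := exists_pow_lt_of_lt_one hρ (by norm_num : (1 / 2 : ℝ) < 1)
  obtain ⟨w, hw, hxw⟩ := exists_word_of_mem_moranSet hx n
  have hlen : moranLen c w ≤ ρ := by
    have := moranLen_le_pow hc w
    rw [hw] at this
    linarith
  refine ENNReal.toReal_pos (ne_of_gt ?_) (measure_ne_top _ _)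
  calc 0 < μ (moranI c w) := by
        rw [hμ]; exact ENNReal.ofReal_pos.2 (cylMass_pos hr w)
    _ ≤ μ (closedBall x ρ) :=
        measure_mono ((moranI_subset_closedBall hxw).trans (closedBall_subset_closedBall hlen))

lemma log_measure_closedBall_le {μ : Measure ℝ} [IsProbabilityMeasure μ]
    {A B s : ℝ} (hB : 2 < B) (hc : ∀ n, 1 ≤ n → B ≤ c n) (hcA : ∀ n, 1 ≤ n → c n ≤ A)
    (hr : ∀ n, 1 ≤ n → 0 < r n ∧ r n ≤ 1 / 2) (hs0 : 0 ≤ s)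
    (hs : ∀ n, 1 ≤ n → Real.log (1 - r n) ≤ -(s * Real.log (c n)))
    (hμ : ∀ w : List Bool, μ (moranI c w) = ENNReal.ofReal (cylMass r w 1 1))
    {x ρ : ℝ} (hx : x ∈ moranSet c) (hρ : 0 < ρ) (hρ1 : ρ < 1 - 2 / B) :
    Real.log (μ (closedBall x ρ)).toReal ≤
      s * (Real.log ρ + Real.log A - Real.log (1 - 2 / B)) := by
  have hc2 : ∀ n, 1 ≤ n → 2 < c n := fun n hn => by linarith [hc n hn]
  have hc0 : ∀ n, 1 ≤ n → 0 < c n := fun n hn => by linarith [hc n hn]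
  have hr1 : ∀ n, 1 ≤ n → 0 < r n ∧ r n < 1 :=
    fun n hn => ⟨(hr n hn).1, by linarith [(hr n hn).2]⟩
  have hA : 0 < A := by linarith [hc 1 le_rfl, hcA 1 le_rfl]
  set δ := 1 - 2 / B with hδ_def
  have hδ : 0 < δ := hρ.trans hρ1
  let L : ℕ → ℝ := fun n => moranLen c (List.replicate n false)
  have hLw : ∀ w : List Bool, moranLen c w = L w.length :=
    fun w => moranLen_eq_of_length_eq (by simp)
  have hex : ∃ n, δ * L n ≤ ρ := by
    obtain ⟨n, hn⟩ := exists_pow_lt_of_lt_one (div_pos hρ hδ) (by norm_num : (1 / 2 : ℝ) < 1)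
    refine ⟨n, ?_⟩
    have h := moranLen_le_pow hc2 (List.replicate n false)
    rw [List.length_replicate] at h
    rw [lt_div_iff₀ hδ] at hn
    have : δ * L n ≤ δ * (1 / 2) ^ n := by gcongr
    linarith
  classical
  have hspec := Nat.find_spec hex
  have hmin := fun m => Nat.find_min hex (m := m)
  generalize Nat.find hex = n at hspec hmin
  obtain _ | n := n
  · have : L 0 = 1 := by simp [L, moranLen, moranCyl]
    rw [this] at hspec
    linarith
  have hn : ρ < δ * L n := not_le.1 (hmin n (by omega))
  obtain ⟨w, hw, hxw⟩ := exists_word_of_mem_moranSet hx n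
  have hball := measure_closedBall_le hB hc hr1 hμ w hxw (by rw [hLw, hw]; exact hn)
  have hle : (μ (closedBall x ρ)).toReal ≤ cylMass r w 1 1 := by
    rw [hμ] at hball
    exact ENNReal.toReal_le_of_le_ofReal (cylMass_pos hr1 w).le hball
  have h1 := Real.log_le_log (measure_closedBall_toReal_pos hc2 hr1 hμ hx hρ) hle
  have h2 := log_cylMass_le hc0 hr hs w
  have h3 : Real.log (moranLen c w) ≤ Real.log ρ + Real.log A - Real.log δ := by
    have h4 := log_moranLen_append_singleton hc0 false w
    have h5 : Real.log (c (1 + w.length)) ≤ Real.log A :=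
      Real.log_le_log (hc0 _ (by omega)) (hcA _ (by omega))
    have h6 : Real.log δ + Real.log (moranLen c (w ++ [false])) ≤ Real.log ρ := by
      have hpos := moranLen_pos hc0 (w ++ [false])
      rw [← Real.log_mul hδ.ne' hpos.ne']
      refine Real.log_le_log (mul_pos hδ hpos) ?_
      rw [hLw, List.length_append, hw]
      exact hspec
    linarith
  calc _ ≤ s * Real.log (moranLen c w) := h1.trans h2
    _ ≤ _ := by gcongr

end Cylinders

/-- The lower local dimension is at most `t` once the mass of the ball is bounded below along a
sequence of radii. -/
lemma lowerLocalDim_le_of_tendsto {μ : Measure ℝ} [IsProbabilityMeasure μ] {x t : ℝ}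
    {u e : ℕ → ℝ} (hu : Tendsto u atTop (𝓝[>] 0)) (he : Tendsto e atTop (𝓝 0))
    (h : ∀ᶠ i in atTop,
      Real.log (μ (closedBall x (u i))).toReal / Real.log (u i) ≤ t + e i) :
    lowerLocalDim μ x ≤ t ∧ IsCoboundedUnder (· ≥ ·) (𝓝[>] (0 : ℝ))
      (fun ρ : ℝ => Real.log (μ (closedBall x ρ)).toReal / Real.log ρ) := by
  have hfreq : ∀ ε > 0, ∃ᶠ ρ in 𝓝[>] (0 : ℝ),
      Real.log (μ (closedBall x ρ)).toReal / Real.log ρ ≤ t + ε := by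
    intro ε hε
    refine hu.frequently (Eventually.frequently ?_)
    filter_upwards [h, he.eventually_lt_const hε] with i hi hi'
    linarith
  have hbdd : IsBoundedUnder (· ≥ ·) (𝓝[>] (0 : ℝ))
      (fun ρ : ℝ => Real.log (μ (closedBall x ρ)).toReal / Real.log ρ) := by
    refine isBoundedUnder_of_eventually_ge (a := 0) ?_
    filter_upwards [Ioo_mem_nhdsGT (show (0 : ℝ) < 1 by norm_num)] with ρ hρ
    refine div_nonneg_of_nonpos (Real.log_nonpos ENNReal.toReal_nonneg ?_)
      (Real.log_nonpos hρ.1.le hρ.2.le)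
    exact ENNReal.toReal_le_of_le_ofReal zero_le_one (by simpa using prob_le_one)
  exact ⟨le_of_forall_pos_le_add fun ε hε => liminf_le_of_frequently_le (hfreq ε hε) hbdd,
    IsCoboundedUnder.of_frequently_le (hfreq 1 one_pos)⟩

/-- The lower local dimension is at least `s` if `μ(B(x,ρ)) ≤ C ρ ^ s` for small `ρ`. -/
lemma le_lowerLocalDim_of_log_le {μ : Measure ℝ} {x s K : ℝ}
    (hcob : IsCoboundedUnder (· ≥ ·) (𝓝[>] (0 : ℝ))
      (fun ρ : ℝ => Real.log (μ (closedBall x ρ)).toReal / Real.log ρ))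
    (h : ∀ᶠ ρ in 𝓝[>] (0 : ℝ),
      Real.log (μ (closedBall x ρ)).toReal ≤ s * Real.log ρ + K) :
    s ≤ lowerLocalDim μ x := by
  have hlim : Tendsto (fun ρ : ℝ => K / Real.log ρ) (𝓝[>] 0) (𝓝 0) :=
    tendsto_const_nhds.div_atBot Real.tendsto_log_nhdsGT_zero
  refine le_of_forall_pos_le_add fun ε hε => ?_
  rw [← sub_le_iff_le_add]
  refine le_liminf_of_le hcob ?_
  filter_upwards [h, hlim.eventually_const_lt (neg_lt_zero.2 hε),
    Ioo_mem_nhdsGT (show (0 : ℝ) < 1 by norm_num)] with ρ h1 h2 hρ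
  have hlog := Real.log_neg hρ.1 hρ.2
  have h3 : s + K / Real.log ρ ≤ Real.log (μ (closedBall x ρ)).toReal / Real.log ρ := by
    rw [le_div_iff_of_neg hlog, add_mul, div_mul_cancel₀ _ hlog.ne]
    exact h1
  linarith

lemma exists_lt_and_le_succ {N : ℕ → ℕ} (hN0 : N 0 = 0) (hN : StrictMono N) {n : ℕ}
    (hn : 1 ≤ n) : ∃ j, N j < n ∧ n ≤ N (j + 1) := by
  classical
  have hex : ∃ j, n ≤ N j := ⟨n, hN.le_apply⟩
  have hspec := Nat.find_spec hex
  have hmin := fun m => Nat.find_min hex (m := m)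
  generalize Nat.find hex = k at hspec hmin
  obtain _ | k := k
  · omega
  · exact ⟨k, not_le.1 (hmin k (by omega)), hspec⟩

/-- for every point x in X = supp(μ), the lower local dimension satisfies
−log(1−p)/log A ≤ d̲(μ,x) ≤ −log p/log A. -/
theorem stmt_0 (A B p q : ℝ) (N : ℕ → ℕ)
    (hBA : B < A) (hB2 : 2 < B)
    (hp0 : 0 < p) (hp2 : p ≤ 1 / 2) (hq0 : 0 < q) (hq2 : q ≤ 1 / 2)
    (hN0 : N 0 = 0) (hNmono : StrictMono N)
    (hNlim : Tendsto (fun i : ℕ => (N (i + 1) : ℝ) / (N i : ℝ)) atTop atTop)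
    (hpq : -Real.log p / Real.log A < -Real.log (1 - q) / Real.log B)
    (c r : ℕ → ℝ)
    (hcA : ∀ i n : ℕ, N (2 * i) < n → n ≤ N (2 * i + 1) → c n = A)
    (hcB : ∀ i n : ℕ, N (2 * i + 1) < n → n ≤ N (2 * i + 2) → c n = B)
    (hrp : ∀ i n : ℕ, N (2 * i) < n → n ≤ N (2 * i + 1) → r n = p)
    (hrq : ∀ i n : ℕ, N (2 * i + 1) < n → n ≤ N (2 * i + 2) → r n = q)
    (μ : Measure ℝ) [IsProbabilityMeasure μ]
    (hμ : ∀ w : List Bool, μ (moranI c w) = ENNReal.ofReal (cylMass r w 1 1))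
    (x : ℝ) (hx : x ∈ moranSet c) :
    -Real.log (1 - p) / Real.log A ≤ lowerLocalDim μ x ∧
      lowerLocalDim μ x ≤ -Real.log p / Real.log A := by
  have hA0 : 0 < Real.log A := Real.log_pos (by linarith)
  have hB0 : 0 < Real.log B := Real.log_pos (by linarith)
  have hlogp : Real.log p < 0 := Real.log_neg hp0 (by linarith)
  have hlogq : Real.log q < 0 := Real.log_neg hq0 (by linarith)
  have hpp : Real.log p ≤ Real.log (1 - p) := Real.log_le_log hp0 (by linarith)
  have hcr : ∀ n, 1 ≤ n → (c n = A ∧ r n = p) ∨ (c n = B ∧ r n = q) := by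
    intro n hn
    obtain ⟨j, h1, h2⟩ := exists_lt_and_le_succ hN0 hNmono hn
    obtain ⟨i, rfl | rfl⟩ := Nat.even_or_odd' j
    · exact Or.inl ⟨hcA i n h1 h2, hrp i n h1 h2⟩
    · exact Or.inr ⟨hcB i n h1 h2, hrq i n h1 h2⟩
  have hc : ∀ n, 1 ≤ n → B ≤ c n := fun n hn => by
    rcases hcr n hn with h | h <;> linarith [h.1]
  have hcA' : ∀ n, 1 ≤ n → c n ≤ A := fun n hn => by
    rcases hcr n hn with h | h <;> linarith [h.1]
  have hc2 : ∀ n, 1 ≤ n → 2 < c n := fun n hn => by linarith [hc n hn]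
  have hc0 : ∀ n, 1 ≤ n → 0 < c n := fun n hn => by linarith [hc n hn]
  have hr : ∀ n, 1 ≤ n → 0 < r n ∧ r n ≤ 1 / 2 := fun n hn => by
    rcases hcr n hn with ⟨-, h⟩ | ⟨-, h⟩ <;> rw [h] <;> constructor <;> assumption
  have hr1 : ∀ n, 1 ≤ n → 0 < r n ∧ r n < 1 :=
    fun n hn => ⟨(hr n hn).1, by linarith [(hr n hn).2]⟩
  set s := -Real.log (1 - p) / Real.log A with hs_def
  set t := -Real.log p / Real.log A with ht_def
  have hsA : s * Real.log A = -Real.log (1 - p) := div_mul_cancel₀ _ hA0.ne'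
  have htA : t * Real.log A = -Real.log p := div_mul_cancel₀ _ hA0.ne'
  have hs0 : 0 ≤ s :=
    div_nonneg (neg_nonneg.2 (Real.log_nonpos (by linarith) (by linarith))) hA0.le
  have hst : s ≤ t := div_le_div_of_nonneg_right (by linarith) hA0.le
  have hsB : s * Real.log B ≤ -Real.log (1 - q) :=
    ((lt_div_iff₀ hB0).1 (hst.trans_lt hpq)).le
  have hs : ∀ n, 1 ≤ n → Real.log (1 - r n) ≤ -(s * Real.log (c n)) := fun n hn => by
    rcases hcr n hn with ⟨h1, h2⟩ | ⟨h1, h2⟩ <;> rw [h1, h2] <;> linarith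
  choose w hw hxw using exists_word_of_mem_moranSet hx
  have hlog2 : 0 < Real.log 2 := Real.log_pos (by norm_num)
  have hodd : Tendsto (fun i => N (2 * i + 1)) atTop atTop :=
    hNmono.tendsto_atTop.comp (tendsto_atTop_mono (fun i => by simp only [id]; omega) tendsto_id)
  have hu : Tendsto (fun i => moranLen c (w (N (2 * i + 1)))) atTop (𝓝[>] 0) := by
    refine tendsto_nhdsWithin_iff.2 ⟨?_, Eventually.of_forall fun i => moranLen_pos hc0 _⟩
    refine squeeze_zero (fun i => (moranLen_pos hc0 _).le)
      (fun i => moranLen_le_pow hc2 (w (N (2 * i + 1)))) ?_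
    simp only [hw]
    exact (tendsto_pow_atTop_nhds_zero_of_lt_one (by norm_num) (by norm_num)).comp hodd
  have he : Tendsto (fun i => -Real.log q / Real.log 2 *
      ((N (2 * i + 1) : ℝ) / (N (2 * i) : ℝ))⁻¹) atTop (𝓝 0) := by
    have h1 : Tendsto (fun i : ℕ => 2 * i) atTop atTop :=
      tendsto_atTop_mono (fun i => by simp only [id]; omega) tendsto_id
    simpa using (hNlim.comp h1).inv_tendsto_atTop.const_mul (-Real.log q / Real.log 2)
  obtain ⟨hupper, hcob⟩ := lowerLocalDim_le_of_tendsto (μ := μ) (x := x) (t := t) hu he <| by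
    refine Eventually.of_forall fun i => ?_
    have hn : 0 < N (2 * i + 1) := by
      have := hNmono (show 2 * i < 2 * i + 1 by omega)
      omega
    set n := N (2 * i + 1) with hn_def
    have hlow := le_log_cylMass (t := t) (K := -Real.log q) (m := N (2 * i)) (n := n)
      hc0 hr
      (fun k hk _ => by
        have ht0 : 0 ≤ t := hs0.trans hst
        rcases hcr k hk with ⟨h1, h2⟩ | ⟨h1, h2⟩ <;> rw [h1, h2]
        · linarith
        · linarith [mul_nonneg ht0 hB0.le])
      (fun k hk hk' => by rw [hcA i k hk hk', hrp i k hk hk']; linarith)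
      (w n) (hw n).le
    rw [hw, min_eq_right (hNmono (show 2 * i < 2 * i + 1 by omega)).le] at hlow
    have hmass : Real.log (cylMass r (w n) 1 1) ≤
        Real.log (μ (closedBall x (moranLen c (w n)))).toReal := by
      refine Real.log_le_log (cylMass_pos hr1 _) ?_
      have h := measure_mono (μ := μ) (moranI_subset_closedBall (hxw n))
      rw [hμ] at h
      exact (ENNReal.ofReal_le_iff_le_toReal (measure_ne_top _ _)).1 h
    have hlen := log_moranLen_le hc2 (w n)
    rw [hw] at hlen
    have hn' : (0 : ℝ) < n := by exact_mod_cast hn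
    have hneg : Real.log (moranLen c (w n)) < 0 := by
      have := mul_pos hn' hlog2
      linarith
    rw [div_le_iff_of_neg hneg]
    have hE : 0 ≤ -Real.log q / Real.log 2 * ((n : ℝ) / (N (2 * i) : ℝ))⁻¹ :=
      mul_nonneg (div_nonneg (by linarith) hlog2.le) (by positivity)
    have hmul := mul_le_mul_of_nonneg_left hlen hE
    have hval : -Real.log q / Real.log 2 * ((n : ℝ) / (N (2 * i) : ℝ))⁻¹ *
        -(n * Real.log 2) = Real.log q * N (2 * i) := by
      rw [inv_div]
      field_simp
    rw [hval] at hmul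
    linarith
  refine ⟨le_lowerLocalDim_of_log_le (K := s * (Real.log A - Real.log (1 - 2 / B))) hcob ?_,
    hupper⟩
  have hδ : 0 < 1 - 2 / B := sub_pos.2 ((div_lt_one (by linarith)).2 hB2)
  filter_upwards [Ioo_mem_nhdsGT hδ] with ρ hρ
  have := log_measure_closedBall_le hB2 hc hcA' hr hs0 hs hμ hx hρ.1 hρ.2
  linarith
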